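/- arXiv:2504.11033 — 2 statements merged into one kernel-verified Lean document; each statement's English description precedes it below -/
import Mathlib

section
/- Let X be a complex Banach space, A a positive operator on X, and 0 < α < β < 1. Assume A^{-α}, A^{-β} and A^{-(β-α)} (given by the Balakrishnan formula) are injective, and write A^{γ} for the inverse of A^{-γ} with domain D(A^{γ}) = Range(A^{-γ}). Then for every x ∈ D(A^{β}) one has x ∈ D(A^{α}), A^{α}x = A^{-(β-α)}(A^{β}x), and hence ‖A^{α}x‖ ≤ ‖A^{-(β-α)}‖·‖A^{β}x‖; i.e., the embedding X^{β} ↪ X^{α} is continuous. -/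
open MeasureTheory Real Set

noncomputable section

/-- `R` is a two-sided bounded inverse of `lam + A : D(A) → X`;
in particular `lam + A` is bijective from `D(A)` onto `X` with bounded inverse `R`. -/
def ResolventAt {X : Type*} [NormedAddCommGroup X] [NormedSpace ℂ X]
    (A : X →ₗ.[ℂ] X) (lam : ℂ) (R : X →L[ℂ] X) : Prop :=
  (∀ x : A.domain, R (lam • (x : X) + A x) = x) ∧
  (∀ y : X, ∃ h : R y ∈ A.domain, lam • R y + A ⟨R y, h⟩ = y)

/-- `A` is a positive operator with constant `M ≥ 1` and resolvent family `R`. -/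
structure IsPositive {X : Type*} [NormedAddCommGroup X] [NormedSpace ℂ X]
    (A : X →ₗ.[ℂ] X) (M : ℝ) (R : ℝ → X →L[ℂ] X) : Prop where
  dense_domain : Dense (A.domain : Set X)
  closed_graph : IsClosed (A.graph : Set (X × X))
  one_le : 1 ≤ M
  resolvent : ∀ s : ℝ, 0 ≤ s → ResolventAt A (s : ℂ) (R s)
  bound : ∀ s : ℝ, 0 ≤ s → (1 + s) * ‖R s‖ ≤ M

/-- The Balakrishnan fractional power `A ^ (-α)`, expressed through the
resolvent family `R` of `A`:  `A⁻ᵅ = (sin (π α) / π) ∫₀^∞ s⁻ᵅ (s+A)⁻¹ ds`. -/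
def negPow {X : Type*} [NormedAddCommGroup X] [NormedSpace ℂ X]
    (R : ℝ → X →L[ℂ] X) (α : ℝ) : X →L[ℂ] X :=
  (Real.sin (π * α) / π) • ∫ s in Ioi (0 : ℝ), s ^ (-α) • R s


lemma aux_scalar_int {γ : ℝ} (h0 : 0 < γ) (h1 : γ < 1) :
    IntegrableOn (fun s : ℝ => s ^ (-γ) * (1 + s)⁻¹) (Ioi 0) := by
  have hm : ∀ S : Set ℝ, AEStronglyMeasurable (fun s : ℝ => s ^ (-γ) * (1 + s)⁻¹)
      (volume.restrict S) := fun S => by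
    apply Measurable.aestronglyMeasurable
    fun_prop
  rw [← Ioc_union_Ioi_eq_Ioi (zero_le_one : (0:ℝ) ≤ 1)]
  apply IntegrableOn.union
  · have : IntegrableOn (fun s : ℝ => s ^ (-γ)) (Ioc 0 1) := by
      have := intervalIntegral.intervalIntegrable_rpow' (a := 0) (b := 1) (r := -γ) (by linarith)
      rwa [intervalIntegrable_iff_integrableOn_Ioc_of_le zero_le_one] at this
    refine Integrable.mono' this (hm _) ?_
    filter_upwards [ae_restrict_mem measurableSet_Ioc] with s hs
    have hs0 : 0 < s := hs.1
    rw [Real.norm_of_nonneg (by positivity)]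
    exact mul_le_of_le_one_right (by positivity) (inv_le_one_of_one_le₀ (by linarith))
  · have : IntegrableOn (fun s : ℝ => s ^ (-γ - 1)) (Ioi 1) :=
      integrableOn_Ioi_rpow_of_lt (by linarith) one_pos
    refine Integrable.mono' this (hm _) ?_
    filter_upwards [ae_restrict_mem measurableSet_Ioi] with s hs
    have hs0 : 0 < s := lt_trans one_pos hs
    rw [Real.norm_of_nonneg (by positivity), rpow_sub_one hs0.ne', div_eq_mul_inv]
    gcongr
    linarith

lemma aux_scalar_val {γ : ℝ} (h0 : 0 < γ) (h1 : γ < 1) :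
    ∫ s in Ioi (0:ℝ), s ^ (-γ) * (1 + s)⁻¹ = π / Real.sin (π * γ) := by
  rw [← Real.Gamma_mul_Gamma_one_sub]
  have hin : ∀ s ∈ Ioi (0:ℝ), ∫ t in Ioi (0:ℝ), s ^ (-γ) * rexp (-(1 + s) * t)
      = s ^ (-γ) * (1 + s)⁻¹ := by
    intro s hs
    have hs0 : 0 < s := hs
    rw [integral_const_mul, integral_exp_mul_Ioi (by linarith)]
    congr 1
    rw [mul_zero, Real.exp_zero, neg_div_neg_eq, one_div]
  have hprod : Integrable (Function.uncurry fun s t : ℝ => s ^ (-γ) * rexp (-(1 + s) * t))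
      ((volume.restrict (Ioi 0)).prod (volume.restrict (Ioi 0))) := by
    rw [integrable_prod_iff]
    · constructor
      · filter_upwards [ae_restrict_mem measurableSet_Ioi] with s hs
        have hs0 : 0 < s := hs
        exact (integrableOn_exp_mul_Ioi (a := -(1 + s)) (by linarith) 0).const_mul (s ^ (-γ))
      · refine (aux_scalar_int h0 h1).congr ?_
        filter_upwards [ae_restrict_mem measurableSet_Ioi] with s hs
        have hs0 : 0 < s := hs
        rw [← hin s hs]
        refine integral_congr_ae (Filter.Eventually.of_forall fun t => ?_)
        exact (Real.norm_of_nonneg (by positivity)).symm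
    · apply Measurable.aestronglyMeasurable
      unfold Function.uncurry
      fun_prop
  rw [← setIntegral_congr_fun measurableSet_Ioi hin, integral_integral_swap hprod]
  rw [Real.Gamma_eq_integral h0, ← integral_mul_const]
  refine setIntegral_congr_fun measurableSet_Ioi fun t ht => ?_
  have ht0 : 0 < t := ht
  have := Real.integral_rpow_mul_exp_neg_mul_Ioi (a := 1 - γ) (by linarith) ht0
  have e : ∀ s : ℝ, s ^ (-γ) * rexp (-(1 + s) * t)
      = rexp (-t) * (s ^ (1 - γ - 1) * rexp (-(t * s))) := by
    intro s
    rw [show -(1 + s) * t = -t + -(t * s) by ring, Real.exp_add,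
      show 1 - γ - 1 = -γ by ring]
    ring
  simp_rw [e]
  rw [integral_const_mul, this, one_div, Real.inv_rpow ht0.le, ← Real.rpow_neg ht0.le,
    show -(1 - γ) = γ - 1 by ring]
  ring

section abstractAlg

variable {E : Type*} [NormedRing E] [NormedSpace ℝ E] [IsScalarTower ℝ E E]
  [SMulCommClass ℝ E E] [CompleteSpace E]

lemma aux_cont {M : ℝ} {R : ℝ → E}
    (hid : ∀ s t : ℝ, 0 < s → 0 < t → R s - R t = (t - s) • (R s * R t))
    (hb : ∀ s : ℝ, 0 < s → ‖R s‖ ≤ M * (1 + s)⁻¹) : ContinuousOn R (Ioi 0) := by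
  have hbM : ∀ s : ℝ, 0 < s → ‖R s‖ ≤ |M| := by
    intro s hs
    refine (hb s hs).trans ?_
    calc M * (1 + s)⁻¹ ≤ |M| * 1 := by
          gcongr
          · exact le_abs_self M
          · exact inv_le_one_of_one_le₀ (by linarith)
      _ = |M| := mul_one _
  have : LipschitzOnWith (Real.toNNReal (|M| * |M|)) R (Ioi 0) := by
    refine LipschitzOnWith.of_dist_le_mul fun s hs t ht => ?_
    rw [dist_eq_norm, hid s t hs ht, norm_smul, dist_comm, dist_eq_norm,
      Real.coe_toNNReal _ (by positivity), mul_comm]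
    gcongr
    exact (norm_mul_le _ _).trans (mul_le_mul (hbM s hs) (hbM t ht) (norm_nonneg _) (abs_nonneg _))
  exact this.continuousOn

lemma aux_int {M : ℝ} {R : ℝ → E} (hc : ContinuousOn R (Ioi 0))
    (hb : ∀ s : ℝ, 0 < s → ‖R s‖ ≤ M * (1 + s)⁻¹) {γ : ℝ} (h0 : 0 < γ) (h1 : γ < 1) :
    IntegrableOn (fun s : ℝ => s ^ (-γ) • R s) (Ioi 0) := by
  refine Integrable.mono' ((aux_scalar_int h0 h1).const_mul M) ?_ ?_
  · refine ContinuousOn.aestronglyMeasurable ?_ measurableSet_Ioi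
    refine ContinuousOn.smul (fun s hs => ?_) hc
    exact (Real.continuousAt_rpow_const _ _ (Or.inl (ne_of_gt hs))).continuousWithinAt
  · filter_upwards [ae_restrict_mem measurableSet_Ioi] with s hs
    have hs0 : 0 < s := hs
    rw [norm_smul, Real.norm_of_nonneg (by positivity)]
    calc s ^ (-γ) * ‖R s‖ ≤ s ^ (-γ) * (M * (1 + s)⁻¹) := by
          gcongr
          exact hb s hs
      _ = _ := by ring

lemma aux_main {M : ℝ} {R : ℝ → E}
    (hid : ∀ s t : ℝ, 0 < s → 0 < t → R s - R t = (t - s) • (R s * R t))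
    (hb : ∀ s : ℝ, 0 < s → ‖R s‖ ≤ M * (1 + s)⁻¹)
    {α δ : ℝ} (hα : 0 < α) (hδ : 0 < δ) (hs1 : α + δ < 1) :
    (∫ s in Ioi (0:ℝ), s ^ (-α) • R s) * (∫ s in Ioi (0:ℝ), s ^ (-δ) • R s)
      = (∫ u in Ioi (0:ℝ), (u ^ (-δ) / (u - 1)) * (1 - u ^ (α + δ) * u⁻¹)) •
        ∫ s in Ioi (0:ℝ), s ^ (-(α + δ)) • R s := by
  have hc := aux_cont hid hb
  have hIα := aux_int hc hb hα (by linarith)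
  have hIδ := aux_int hc hb hδ (by linarith)
  have hIβ := aux_int hc hb (γ := α + δ) (by linarith) hs1
  set F : ℝ → ℝ → E := fun s t => (s ^ (-α) • R s) * (t ^ (-δ) • R t) with hF
  set G : ℝ → ℝ → E := fun s u => s • F s (s * u) with hG
  have hFint : Integrable (Function.uncurry F)
      ((volume.restrict (Ioi 0)).prod (volume.restrict (Ioi 0))) :=
    Integrable.mul_prod hIα hIδ
  have hFs : ∀ s : ℝ, IntegrableOn (F s) (Ioi 0) := fun s => hIδ.const_mul _
  have hGs : ∀ s ∈ Ioi (0:ℝ), ∫ u in Ioi (0:ℝ), G s u = ∫ t in Ioi (0:ℝ), F s t := by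
    intro s hs
    have hs0 : 0 < s := hs
    simp only [hG]
    rw [integral_smul, integral_comp_mul_left_Ioi (F s) 0 hs0, mul_zero, smul_smul,
      mul_inv_cancel₀ hs0.ne', one_smul]
  have hGn : ∀ s ∈ Ioi (0:ℝ), ∫ u in Ioi (0:ℝ), ‖G s u‖ = ∫ t in Ioi (0:ℝ), ‖F s t‖ := by
    intro s hs
    have hs0 : 0 < s := hs
    simp only [hG, norm_smul]
    rw [integral_const_mul, integral_comp_mul_left_Ioi (fun t => ‖F s t‖) 0 hs0, mul_zero,
      smul_eq_mul, ← mul_assoc, Real.norm_of_nonneg hs0.le, mul_inv_cancel₀ hs0.ne', one_mul]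
  have hGint : Integrable (Function.uncurry G)
      ((volume.restrict (Ioi 0)).prod (volume.restrict (Ioi 0))) := by
    rw [integrable_prod_iff]
    · constructor
      · filter_upwards [ae_restrict_mem measurableSet_Ioi] with s hs
        have hs0 : 0 < s := hs
        have := (integrableOn_Ioi_comp_mul_left_iff (F s) 0 hs0).2 (by rw [mul_zero]; exact hFs s)
        exact this.smul s
      · refine hFint.integral_norm_prod_left.congr ?_
        filter_upwards [ae_restrict_mem measurableSet_Ioi] with s hs
        exact (hGn s hs).symm
    · rw [Measure.prod_restrict]
      refine ContinuousOn.aestronglyMeasurable ?_ (measurableSet_Ioi.prod measurableSet_Ioi)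
      have hp : ∀ γ : ℝ, ContinuousOn (fun s : ℝ => s ^ (-γ) • R s) (Ioi 0) := fun γ =>
        ContinuousOn.smul (fun s hs =>
          (Real.continuousAt_rpow_const _ _ (Or.inl (ne_of_gt hs))).continuousWithinAt) hc
      refine ContinuousOn.smul continuousOn_fst (ContinuousOn.mul ?_ ?_)
      · exact (hp α).comp continuousOn_fst fun p hp => hp.1
      · exact (hp δ).comp (g := fun s : ℝ => s ^ (-δ) • R s)
          (f := fun p : ℝ × ℝ => p.1 * p.2) (by fun_prop)
          fun p hp => mul_pos (show (0:ℝ) < p.1 from hp.1) hp.2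
  have key : ∀ u : ℝ, 0 < u → u ≠ 1 → ∫ s in Ioi (0:ℝ), G s u
      = ((u ^ (-δ) / (u - 1)) * (1 - u ^ (α + δ) * u⁻¹)) •
        ∫ s in Ioi (0:ℝ), s ^ (-(α + δ)) • R s := by
    intro u hu hu1
    have hu1' : u - 1 ≠ 0 := sub_ne_zero.2 hu1
    set B : ℝ → E := fun s => s ^ (-(α + δ)) • R s with hB
    have e : ∀ s ∈ Ioi (0:ℝ), G s u
        = (u ^ (-δ) / (u - 1)) • (B s - u ^ (α + δ) • B (u * s)) := by
      intro s hs
      have hs0 : 0 < s := hs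
      have h1 := hid s (s * u) hs0 (mul_pos hs0 hu)
      have h2 : u ^ (α + δ) • B (u * s) = s ^ (-(α + δ)) • R (s * u) := by
        simp only [hB]
        rw [smul_smul, Real.mul_rpow hu.le hs0.le, ← mul_assoc, ← Real.rpow_add hu,
          add_neg_cancel, Real.rpow_zero, one_mul, mul_comm u s]
      rw [h2]
      simp only [hB]
      rw [← smul_sub, h1]
      simp only [hG, hF, smul_mul_assoc, mul_smul_comm, smul_smul]
      congr 1
      rw [Real.mul_rpow hs0.le hu.le, neg_add, Real.rpow_add hs0]
      field_simp
    rw [setIntegral_congr_fun measurableSet_Ioi e, integral_smul, integral_sub hIβ, integral_smul,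
      integral_comp_mul_left_Ioi B 0 hu, mul_zero]
    · module
    exact ((integrableOn_Ioi_comp_mul_left_iff B 0 hu).2 (by rw [mul_zero]; exact hIβ)).smul _
  calc _ = ∫ s in Ioi (0:ℝ), ∫ t in Ioi (0:ℝ), F s t := by
        rw [← integral_mul_const_of_integrable hIα]
        refine integral_congr_ae (Filter.Eventually.of_forall fun s => ?_)
        exact (integral_const_mul_of_integrable hIδ).symm
    _ = ∫ s in Ioi (0:ℝ), ∫ u in Ioi (0:ℝ), G s u :=
        (setIntegral_congr_fun measurableSet_Ioi hGs).symm
    _ = ∫ u in Ioi (0:ℝ), ∫ s in Ioi (0:ℝ), G s u := integral_integral_swap hGint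
    _ = ∫ u in Ioi (0:ℝ), ((u ^ (-δ) / (u - 1)) * (1 - u ^ (α + δ) * u⁻¹)) •
        ∫ s in Ioi (0:ℝ), s ^ (-(α + δ)) • R s := by
        refine integral_congr_ae ?_
        have hne : ∀ᵐ u : ℝ ∂(volume.restrict (Ioi 0)), u ≠ 1 :=
          ae_restrict_of_ae (by simp [ae_iff])
        filter_upwards [ae_restrict_mem measurableSet_Ioi, hne] with u hu hu1
        exact key u hu hu1
    _ = _ := integral_smul_const _ _

end abstractAlg

lemma aux_sin_pos {γ : ℝ} (h0 : 0 < γ) (h1 : γ < 1) : 0 < Real.sin (π * γ) :=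
  Real.sin_pos_of_pos_of_lt_pi (by positivity) (by nlinarith [Real.pi_pos])

lemma aux_const {α δ : ℝ} (hα : 0 < α) (hδ : 0 < δ) (hs1 : α + δ < 1) :
    (∫ u in Ioi (0:ℝ), (u ^ (-δ) / (u - 1)) * (1 - u ^ (α + δ) * u⁻¹))
      * (π / Real.sin (π * (α + δ))) =
    (π / Real.sin (π * α)) * (π / Real.sin (π * δ)) := by
  have := aux_main (E := ℝ) (M := 1) (R := fun s => (1 + s)⁻¹) (α := α) (δ := δ)
    (fun s t hs ht => by
      have : 1 + s ≠ 0 := by positivity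
      have : 1 + t ≠ 0 := by positivity
      simp only [smul_eq_mul]
      field_simp
      ring)
    (fun s hs => by rw [Real.norm_of_nonneg (by positivity), one_mul]) hα hδ hs1
  simp only [smul_eq_mul] at this
  rw [aux_scalar_val hα (by linarith), aux_scalar_val hδ (by linarith),
    aux_scalar_val (by linarith) hs1] at this
  exact this.symm

lemma aux_semigroup {X : Type*} [NormedAddCommGroup X] [NormedSpace ℂ X] [CompleteSpace X]
    (M : ℝ) (A : X →ₗ.[ℂ] X) (R : ℝ → X →L[ℂ] X) (hA : IsPositive A M R)
    {α δ : ℝ} (hα : 0 < α) (hδ : 0 < δ) (hs1 : α + δ < 1) :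
    negPow R α * negPow R δ = negPow R (α + δ) := by
  have hid : ∀ s t : ℝ, 0 < s → 0 < t → R s - R t = (t - s) • (R s * R t) := by
    intro s t hs ht
    ext y
    obtain ⟨h, hy⟩ := (hA.resolvent t ht.le).2 y
    have h1 := (hA.resolvent s hs.le).1 ⟨R t y, h⟩
    simp only at h1
    have h2 : y = ((s:ℂ) • R t y + A ⟨R t y, h⟩) + ((t - s : ℝ) : ℂ) • R t y := by
      conv_lhs => rw [← hy]
      push_cast
      module
    have h3 : R s y = R t y + ((t - s : ℝ) : ℂ) • R s (R t y) := by
      conv_lhs => rw [h2]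
      rw [map_add, h1, map_smul]
    have h4 : ((t - s) • (R s * R t)) y = ((t - s : ℝ) : ℂ) • R s (R t y) := by
      rw [Complex.coe_smul]
      rfl
    rw [h4, ContinuousLinearMap.sub_apply, h3]
    abel
  have hb : ∀ s : ℝ, 0 < s → ‖R s‖ ≤ M * (1 + s)⁻¹ := by
    intro s hs
    rw [← div_eq_mul_inv, le_div_iff₀ (by linarith), mul_comm]
    exact hA.bound s hs.le
  have hmain := aux_main hid hb hα hδ hs1
  have hk := aux_const hα hδ hs1
  have p1 := (aux_sin_pos hα (by linarith)).ne'
  have p2 := (aux_sin_pos hδ (by linarith)).ne'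
  have p3 := (aux_sin_pos (γ := α + δ) (by linarith) hs1).ne'
  have hpi := Real.pi_ne_zero
  unfold negPow
  rw [smul_mul_assoc, mul_smul_comm, hmain, smul_smul, smul_smul]
  congr 1
  have hk' : (∫ u in Ioi (0:ℝ), (u ^ (-δ) / (u - 1)) * (1 - u ^ (α + δ) * u⁻¹)) =
    (π / Real.sin (π * α)) * (π / Real.sin (π * δ)) / (π / Real.sin (π * (α + δ))) := by
    rw [← hk, mul_div_cancel_right₀ _ (div_ne_zero hpi p3)]
  rw [hk']
  field_simp

/-- if `x = A⁻ᵝ y ∈ D(Aᵝ)` (so `Aᵝ x = y`), then `x ∈ D(Aᵅ)`,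
`Aᵅ x = A^{-(β-α)} (Aᵝ x)`, and `‖Aᵅ x‖ ≤ ‖A^{-(β-α)}‖ ‖Aᵝ x‖`:
the embedding `Xᵝ ↪ Xᵅ` is continuous. -/
theorem stmt5 {X : Type*} [NormedAddCommGroup X] [NormedSpace ℂ X] [CompleteSpace X]
    (M : ℝ) (A : X →ₗ.[ℂ] X) (R : ℝ → X →L[ℂ] X) (hA : IsPositive A M R)
    (α β : ℝ) (hα : 0 < α) (hαβ : α < β) (hβ : β < 1)
    (hiα : Function.Injective (negPow R α))
    (hiβ : Function.Injective (negPow R β))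
    (hiδ : Function.Injective (negPow R (β - α))) :
    ∀ x y : X, negPow R β y = x →
      x ∈ Set.range (negPow R α) ∧
      negPow R α (negPow R (β - α) y) = x ∧
      ‖negPow R (β - α) y‖ ≤ ‖negPow R (β - α)‖ * ‖y‖ := by
  intro x y hxy
  have h := aux_semigroup M A R hA hα (sub_pos.2 hαβ) (by linarith : α + (β - α) < 1)
  rw [add_sub_cancel] at h
  have h' : negPow R α (negPow R (β - α) y) = x := by
    rw [← hxy, ← h]
    rfl
  exact ⟨⟨_, h'⟩, h', ContinuousLinearMap.le_opNorm _ _⟩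
end
end

section
/- Let X be a complex Banach space and B a positive operator on X, and let α ∈ (0,1). Write B^{-α} = (sin(πα)/π) ∫₀^∞ s^{-α}(s+B)^{-1} ds and B^{-1} = (0+B)^{-1}. Then the following identities hold, all integrals being convergent Bochner integrals: (i) (sin(πα)/π) ∫₀^∞ s^{-α}[s(s+B)^{-2} + 2(I − s(s+B)^{-1})(s+B)^{-1}] ds = (1+α)·B^{-α}; (ii) (sin(πα)/π) ∫₀^∞ s^{-α}(s+B)^{-2} ds = α·B^{-1}∘B^{-α}; (iii) for every x ∈ D(B), (sin(πα)/π) ∫₀^∞ s^{-α} (I − s(s+B)^{-1})² x ds = α·B^{-α}(Bx); (iv) (sin(πα)/π) ∫₀^∞ s^{1-α}(s+B)^{-2} ds = (1−α)·B^{-α}; (v) (sin(πα)/π) ∫₀^∞ s^{-α}(s+2B)^{-1} ds = 2^{-α}·B^{-α}, where s + 2B : D(B) → X is bijective with bounded inverse for s ≥ 0. -/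
open MeasureTheory Real Set

noncomputable section

theorem aux_dom (α : ℝ) (hα : α ∈ Ioo (0 : ℝ) 1) :
    IntegrableOn (fun s : ℝ => s ^ (-α) * (1 + s)⁻¹) (Ioi 0) := by
  rw [← Ioc_union_Ioi_eq_Ioi (zero_le_one' ℝ)]
  have hm : Measurable (fun s : ℝ => s ^ (-α) * (1 + s)⁻¹) := by fun_prop
  refine IntegrableOn.union ?_ ?_
  · have h1 : IntegrableOn (fun s : ℝ => s ^ (-α)) (Ioc 0 1) := by
      rw [← intervalIntegrable_iff_integrableOn_Ioc_of_le zero_le_one]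
      exact intervalIntegral.intervalIntegrable_rpow' (by linarith [hα.2])
    refine Integrable.mono' h1 hm.aestronglyMeasurable ?_
    filter_upwards [ae_restrict_mem measurableSet_Ioc] with s hs
    have h0 : 0 ≤ s ^ (-α) := Real.rpow_nonneg hs.1.le _
    have h2 : 0 ≤ (1 + s)⁻¹ := inv_nonneg.2 (by linarith [hs.1])
    rw [Real.norm_of_nonneg (mul_nonneg h0 h2)]
    exact mul_le_of_le_one_right h0 (inv_le_one_of_one_le₀ (by linarith [hs.1]))
  · have h1 : IntegrableOn (fun s : ℝ => s ^ (-α - 1)) (Ioi 1) :=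
      integrableOn_Ioi_rpow_of_lt (by linarith [hα.1]) one_pos
    refine Integrable.mono' h1 hm.aestronglyMeasurable ?_
    filter_upwards [ae_restrict_mem measurableSet_Ioi] with s hs
    have hs0 : (0 : ℝ) < s := lt_trans one_pos hs
    have h0 : 0 ≤ s ^ (-α) := Real.rpow_nonneg hs0.le _
    have h2 : 0 ≤ (1 + s)⁻¹ := inv_nonneg.2 (by linarith)
    rw [Real.norm_of_nonneg (mul_nonneg h0 h2), Real.rpow_sub_one hs0.ne', div_eq_mul_inv]
    gcongr
    linarith

section aux
variable {X : Type*} [NormedAddCommGroup X] [NormedSpace ℂ X]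
    {M : ℝ} {B : X →ₗ.[ℂ] X} {R : ℝ → X →L[ℂ] X}

theorem aux_res (hB : IsPositive B M R) {s t : ℝ} (hs : 0 ≤ s) (ht : 0 ≤ t) :
    R t - R s = (s - t) • ((R s).comp (R t)) := by
  ext y
  obtain ⟨h, e⟩ := (hB.resolvent t ht).2 y
  have e2 := (hB.resolvent s hs).1 ⟨R t y, h⟩
  have e3 : (s : ℂ) • R t y + B ⟨R t y, h⟩ = y + ((s - t : ℝ) : ℂ) • R t y := by
    rw [← eq_sub_iff_add_eq'] at e
    rw [e]
    push_cast
    module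
  simp only [e3, map_add, map_smul] at e2
  simp only [ContinuousLinearMap.sub_apply, ContinuousLinearMap.smul_apply,
    ContinuousLinearMap.comp_apply]
  rw [sub_eq_iff_eq_add', ← Complex.coe_smul]
  exact e2.symm

theorem aux_bound (hB : IsPositive B M R) {s : ℝ} (hs : 0 ≤ s) : ‖R s‖ ≤ M * (1 + s)⁻¹ := by
  rw [← div_eq_mul_inv, le_div_iff₀' (by linarith)]
  exact hB.bound s hs

theorem aux_bound' (hB : IsPositive B M R) {s : ℝ} (hs : 0 ≤ s) : ‖R s‖ ≤ M := by
  have := hB.bound s hs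
  nlinarith [norm_nonneg (R s)]

theorem aux_bound2 (hB : IsPositive B M R) {s : ℝ} (hs : 0 ≤ s) : ‖s • R s‖ ≤ M := by
  rw [norm_smul, Real.norm_of_nonneg hs]
  have := hB.bound s hs
  nlinarith [norm_nonneg (R s)]

theorem aux_cont_s14 (hB : IsPositive B M R) : ContinuousOn R (Ici 0) := by
  have hM : 0 ≤ M := by linarith [hB.one_le]
  have : LipschitzOnWith (Real.toNNReal (M * M)) R (Ici 0) := by
    refine LipschitzOnWith.of_dist_le_mul fun t ht s hs => ?_
    rw [dist_eq_norm, aux_res hB hs ht, norm_smul, Real.coe_toNNReal _ (by positivity),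
      dist_comm, dist_eq_norm, mul_comm]
    gcongr
    refine (ContinuousLinearMap.opNorm_comp_le _ _).trans ?_
    exact mul_le_mul (aux_bound' hB hs) (aux_bound' hB ht) (norm_nonneg _) hM
  exact this.continuousOn

theorem aux_deriv (hB : IsPositive B M R) {s : ℝ} (hs : 0 < s) :
    HasDerivAt R (-((R s).comp (R s))) s := by
  rw [hasDerivAt_iff_tendsto_slope]
  have hc : ContinuousAt R s := (aux_cont_s14 hB).continuousAt (Ici_mem_nhds hs)
  have h1 : Filter.Tendsto (fun t => -((R s).comp (R t))) (nhds s)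
      (nhds (-((R s).comp (R s)))) := by
    have : ContinuousAt (fun t => -((R s).comp (R t))) s :=
      (continuousAt_const.clm_comp hc).neg
    exact this
  refine (h1.mono_left nhdsWithin_le_nhds).congr' ?_
  filter_upwards [self_mem_nhdsWithin, nhdsWithin_le_nhds (Ioi_mem_nhds hs)] with t ht ht0
  have : t - s ≠ 0 := sub_ne_zero.2 ht
  rw [slope_def_module, aux_res hB hs.le (le_of_lt ht0), smul_smul,
    show (t - s)⁻¹ * (s - t) = -1 by field_simp; ring]
  simp

theorem aux_int_s14 (hB : IsPositive B M R) {α : ℝ} (hα : α ∈ Ioo (0 : ℝ) 1)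
    {E : Type*} [NormedAddCommGroup E] [NormedSpace ℝ E] (C : ℝ) (f : ℝ → E)
    (hf : ContinuousOn f (Ioi 0)) (hb : ∀ s, 0 < s → ‖f s‖ ≤ C * (1 + s)⁻¹) :
    IntegrableOn (fun s : ℝ => s ^ (-α) • f s) (Ioi 0) := by
  refine Integrable.mono' ((aux_dom α hα).const_mul C) ?_ ?_
  · refine ContinuousOn.aestronglyMeasurable ?_ measurableSet_Ioi
    refine ContinuousOn.smul ?_ hf
    intro s hs
    exact (Real.continuousAt_rpow_const _ _ (Or.inl (ne_of_gt hs))).continuousWithinAt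
  · filter_upwards [ae_restrict_mem measurableSet_Ioi] with s hs
    have h0 : 0 ≤ s ^ (-α) := Real.rpow_nonneg (le_of_lt hs) _
    rw [norm_smul, Real.norm_of_nonneg h0]
    calc _ ≤ s ^ (-α) * (C * (1 + s)⁻¹) := mul_le_mul_of_nonneg_left (hb s hs) h0
      _ = _ := by ring

theorem aux_pow {α s : ℝ} (hs : 0 < s) : s ^ (1 - α) = s ^ (-α) * s := by
  rw [show 1 - α = -α + 1 by ring, Real.rpow_add_one hs.ne']

theorem aux_I1 (hB : IsPositive B M R) {α : ℝ} (hα : α ∈ Ioo (0 : ℝ) 1) :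
    IntegrableOn (fun s : ℝ => s ^ (-α) • R s) (Ioi 0) :=
  aux_int_s14 hB hα M _ ((aux_cont_s14 hB).mono Ioi_subset_Ici_self)
    fun _ hs => aux_bound hB (le_of_lt hs)

theorem aux_c2 (hB : IsPositive B M R) :
    ContinuousOn (fun s => (R s).comp (R s)) (Ioi 0) :=
  ((aux_cont_s14 hB).mono Ioi_subset_Ici_self).clm_comp ((aux_cont_s14 hB).mono Ioi_subset_Ici_self)

theorem aux_I2 (hB : IsPositive B M R) {α : ℝ} (hα : α ∈ Ioo (0 : ℝ) 1) :
    IntegrableOn (fun s : ℝ => s ^ (-α) • (s • (R s).comp (R s))) (Ioi 0) := by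
  have hM : 0 ≤ M := by linarith [hB.one_le]
  refine aux_int_s14 hB hα (M * M) _ (continuousOn_id.smul (aux_c2 hB)) fun s hs => ?_
  rw [← ContinuousLinearMap.smul_comp, mul_assoc]
  exact (ContinuousLinearMap.opNorm_comp_le _ _).trans
    (mul_le_mul (aux_bound2 hB hs.le) (aux_bound hB hs.le) (norm_nonneg _) hM)

theorem aux_I3 (hB : IsPositive B M R) {α : ℝ} (hα : α ∈ Ioo (0 : ℝ) 1) :
    IntegrableOn (fun s : ℝ => s ^ (-α) • (R s).comp (R s)) (Ioi 0) := by
  have hM : 0 ≤ M := by linarith [hB.one_le]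
  refine aux_int_s14 hB hα (M * M) _ (aux_c2 hB) fun s hs => ?_
  rw [mul_assoc]
  exact (ContinuousLinearMap.opNorm_comp_le _ _).trans
    (mul_le_mul (aux_bound' hB hs.le) (aux_bound hB hs.le) (norm_nonneg _) hM)

theorem aux_main_s14 [CompleteSpace X] (hB : IsPositive B M R) {α : ℝ} (hα : α ∈ Ioo (0 : ℝ) 1) :
    ∫ s in Ioi (0 : ℝ), s ^ (-α) • (s • (R s).comp (R s))
      = (1 - α) • ∫ s in Ioi (0 : ℝ), s ^ (-α) • R s := by
  have hM : 0 ≤ M := by linarith [hB.one_le]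
  have hint := ((aux_I1 hB hα).smul (1 - α)).sub (aux_I2 hB hα)
  have key := integral_Ioi_of_hasDerivAt_of_tendsto (a := 0) (m := (0 : X →L[ℂ] X))
    (f := fun s : ℝ => s ^ (1 - α) • R s)
    (f' := (1 - α) • (fun s : ℝ => s ^ (-α) • R s) - fun s : ℝ => s ^ (-α) • (s • (R s).comp (R s)))
    ?_ ?_ hint ?_
  · have e := integral_sub ((aux_I1 hB hα).smul (1 - α)) (aux_I2 hB hα)
    simp only [Pi.sub_apply, Pi.smul_apply] at key e
    rw [e, integral_smul, Real.zero_rpow (by linarith [hα.2]), zero_smul, sub_zero] at key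
    exact (sub_eq_zero.1 key).symm
  · have hc : ContinuousWithinAt (fun s : ℝ => s ^ (1 - α)) (Ici 0) 0 :=
      (Real.continuousAt_rpow_const _ _ (Or.inr (by linarith [hα.2]))).continuousWithinAt
    exact hc.smul ((aux_cont_s14 hB) 0 self_mem_Ici)
  · intro s hs
    have hs0 : (0 : ℝ) < s := hs
    have h1 := (Real.hasDerivAt_rpow_const (x := s) (p := 1 - α) (Or.inl hs0.ne')).smul
      (aux_deriv hB hs0)
    refine h1.congr_deriv ?_
    simp only [Pi.sub_apply, Pi.smul_apply]
    rw [aux_pow hs0, show 1 - α - 1 = -α by ring]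
    module
  · rw [tendsto_zero_iff_norm_tendsto_zero]
    have h2 : Filter.Tendsto (fun s : ℝ => M * s ^ (-α)) Filter.atTop (nhds 0) := by
      simpa using (tendsto_rpow_neg_atTop hα.1).const_mul M
    refine squeeze_zero' (Filter.Eventually.of_forall fun _ => norm_nonneg _) ?_ h2
    filter_upwards [Filter.eventually_gt_atTop 0] with s hs
    have h0 : 0 ≤ s ^ (-α) := Real.rpow_nonneg hs.le _
    rw [aux_pow hs, ← smul_smul, norm_smul, Real.norm_of_nonneg h0, mul_comm]
    exact mul_le_mul_of_nonneg_right (aux_bound2 hB hs.le) h0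

theorem aux_R2 (hB : IsPositive B M R) {R2 : ℝ → X →L[ℂ] X}
    (hR2 : ∀ s : ℝ, 0 ≤ s → ResolventAt ((2 : ℂ) • B) (s : ℂ) (R2 s)) {s : ℝ} (hs : 0 ≤ s) :
    R2 s = (2⁻¹ : ℝ) • R (2⁻¹ * s) := by
  ext y
  obtain ⟨h, e⟩ := (hB.resolvent (2⁻¹ * s) (by positivity)).2 y
  have e2 := (hR2 s hs).1 ⟨R (2⁻¹ * s) y, h⟩
  have e3 : (s : ℂ) • R (2⁻¹ * s) y + ((2 : ℂ) • B) ⟨R (2⁻¹ * s) y, h⟩ = (2 : ℂ) • y := by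
    rw [LinearPMap.smul_apply]
    conv_rhs => rw [← e]
    push_cast
    module
  simp only [e3, map_smul] at e2
  rw [ContinuousLinearMap.smul_apply, ← e2, ← Complex.coe_smul, smul_smul]
  norm_num

end aux

/-- the five Balakrishnan-type identities used to compute the fractional
powers of `Λ₍₃,₁/₂₎`, where `R` is the resolvent family of `B` and `R2` that of `2B`.
Note `B²(s+B)⁻² = (I - s(s+B)⁻¹)²` and
`(s+2B)(s+B)⁻² = s(s+B)⁻² + 2(I - s(s+B)⁻¹)(s+B)⁻¹`. -/
theorem stmt14 {X : Type*} [NormedAddCommGroup X] [NormedSpace ℂ X] [CompleteSpace X]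
    (M : ℝ) (B : X →ₗ.[ℂ] X) (R : ℝ → X →L[ℂ] X) (hB : IsPositive B M R)
    (R2 : ℝ → X →L[ℂ] X) (hR2 : ∀ s : ℝ, 0 ≤ s → ResolventAt ((2 : ℂ) • B) (s : ℂ) (R2 s))
    (α : ℝ) (hα : α ∈ Ioo (0 : ℝ) 1) :
    -- (i)  ∫ s⁻ᵅ (s+2B)(s+B)⁻² ds = (1+α) B⁻ᵅ
    (IntegrableOn (fun s : ℝ =>
        s ^ (-α) • (s • ((R s).comp (R s)) + 2 • (R s - s • ((R s).comp (R s))))) (Ioi 0) ∧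
      (Real.sin (π * α) / π) • ∫ s in Ioi (0 : ℝ),
          s ^ (-α) • (s • ((R s).comp (R s)) + 2 • (R s - s • ((R s).comp (R s))))
        = (1 + α) • negPow R α) ∧
    -- (ii)  ∫ s⁻ᵅ (s+B)⁻² ds = α B⁻¹ B⁻ᵅ
    (IntegrableOn (fun s : ℝ => s ^ (-α) • ((R s).comp (R s))) (Ioi 0) ∧
      (Real.sin (π * α) / π) • ∫ s in Ioi (0 : ℝ), s ^ (-α) • ((R s).comp (R s))
        = α • ((R 0).comp (negPow R α))) ∧
    -- (iii)  ∀ x ∈ D(B), ∫ s⁻ᵅ (I - s(s+B)⁻¹)² x ds = α B⁻ᵅ (B x)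
    (∀ x : B.domain,
      IntegrableOn (fun s : ℝ =>
        s ^ (-α) • (((x : X) - s • (R s) (x : X)) -
          s • (R s) ((x : X) - s • (R s) (x : X)))) (Ioi 0) ∧
      (Real.sin (π * α) / π) • ∫ s in Ioi (0 : ℝ),
          s ^ (-α) • (((x : X) - s • (R s) (x : X)) -
            s • (R s) ((x : X) - s • (R s) (x : X)))
        = α • negPow R α (B x)) ∧
    -- (iv)  ∫ s¹⁻ᵅ (s+B)⁻² ds = (1-α) B⁻ᵅ
    (IntegrableOn (fun s : ℝ => s ^ (1 - α) • ((R s).comp (R s))) (Ioi 0) ∧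
      (Real.sin (π * α) / π) • ∫ s in Ioi (0 : ℝ), s ^ (1 - α) • ((R s).comp (R s))
        = (1 - α) • negPow R α) ∧
    -- (v)  ∫ s⁻ᵅ (s+2B)⁻¹ ds = 2⁻ᵅ B⁻ᵅ
    (IntegrableOn (fun s : ℝ => s ^ (-α) • R2 s) (Ioi 0) ∧
      (Real.sin (π * α) / π) • ∫ s in Ioi (0 : ℝ), s ^ (-α) • R2 s
        = ((2 : ℝ) ^ (-α)) • negPow R α) := by
  have hJ1 := aux_I1 hB hα
  have hJ2 := aux_I2 hB hα
  have hJ3 := aux_I3 hB hα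
  have hm := aux_main_s14 hB hα
  have hmd : IntegrableOn (fun s : ℝ => s ^ (-α) • R s - s ^ (-α) • (s • (R s).comp (R s)))
    (Ioi 0) := hJ1.sub hJ2
  have hmd' : ∫ s in Ioi (0 : ℝ), (s ^ (-α) • R s - s ^ (-α) • (s • (R s).comp (R s)))
      = α • ∫ s in Ioi (0 : ℝ), s ^ (-α) • R s := by
    rw [integral_sub hJ1 hJ2, hm]
    module
  refine ⟨?_, ?_, ?_, ?_, ?_⟩
  · have e : (fun s : ℝ =>
        s ^ (-α) • (s • ((R s).comp (R s)) + 2 • (R s - s • ((R s).comp (R s)))))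
        = fun s : ℝ => s ^ (-α) • R s
          + (s ^ (-α) • R s - s ^ (-α) • (s • (R s).comp (R s))) := by
      funext s
      module
    rw [e]
    have hadd : IntegrableOn (fun s : ℝ => s ^ (-α) • R s
          + (s ^ (-α) • R s - s ^ (-α) • (s • (R s).comp (R s)))) (Ioi 0) := by
      refine (((hJ1.smul (2 : ℝ)).sub hJ2).congr ?_)
      refine Filter.Eventually.of_forall fun s => ?_
      simp only [Pi.sub_apply, Pi.smul_apply]
      module
    refine ⟨hadd, ?_⟩
    rw [integral_add hJ1 hmd, hmd', negPow]
    module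
  · refine ⟨hJ3, ?_⟩
    have h1 : ∫ s in Ioi (0 : ℝ), s ^ (-α) • ((R s).comp (R s))
        = ∫ s in Ioi (0 : ℝ), ContinuousLinearMap.compL ℂ X X X (R 0)
          (s ^ (-α) • R s - s ^ (-α) • (s • (R s).comp (R s))) := by
      refine setIntegral_congr_fun measurableSet_Ioi fun s hs => ?_
      have hs0 : (0 : ℝ) < s := hs
      have h := aux_res hB hs0.le le_rfl
      have h' := aux_res hB le_rfl hs0.le
      have h3 : (R 0).comp (R s) - s • (R 0).comp ((R s).comp (R s)) = (R s).comp (R s) := by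
        have : R s = R 0 - s • (R 0).comp (R s) := by
          rw [sub_eq_iff_eq_add'] at h'
          conv_lhs => rw [h']
          module
        conv_rhs => rw [this]
        ext y
        have hy := congrArg (fun T : X →L[ℂ] X => T (R s y)) this
        have hy0 := congrArg (fun T : X →L[ℂ] X => T y) this
        simp only [ContinuousLinearMap.sub_apply, ContinuousLinearMap.smul_apply,
          ContinuousLinearMap.comp_apply] at hy hy0 ⊢
        rw [← hy0, ← hy]
      simp only [ContinuousLinearMap.compL_apply, ContinuousLinearMap.comp_sub]
      conv_lhs => rw [← h3]
      ext y
      simp [smul_sub]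
    rw [h1, ContinuousLinearMap.integral_comp_comm _ hmd, hmd', negPow]
    ext y
    simp [smul_comm α]
  · intro x
    let ev : (X →L[ℂ] X) →L[ℂ] X := ContinuousLinearMap.apply ℂ X (B x)
    have he : EqOn (fun s : ℝ => ev (s ^ (-α) • R s - s ^ (-α) • (s • (R s).comp (R s))))
        (fun s : ℝ => s ^ (-α) • (((x : X) - s • (R s) (x : X)) -
          s • (R s) ((x : X) - s • (R s) (x : X)))) (Ioi 0) := by
      intro s hs
      have h := (hB.resolvent s (le_of_lt hs)).1 x
      rw [map_add, map_smul, Complex.coe_smul, ← eq_sub_iff_add_eq'] at h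
      simp only [ev, ContinuousLinearMap.apply_apply, ContinuousLinearMap.sub_apply,
        ContinuousLinearMap.smul_apply, ContinuousLinearMap.comp_apply]
      rw [← h, smul_sub]
    refine ⟨(integrableOn_congr_fun he measurableSet_Ioi).1 (ev.integrable_comp hmd), ?_⟩
    rw [← setIntegral_congr_fun measurableSet_Ioi he,
      ContinuousLinearMap.integral_comp_comm _ hmd, hmd', negPow]
    simp [ev, smul_comm α]
  · have he : EqOn (fun s : ℝ => s ^ (-α) • (s • (R s).comp (R s)))
        (fun s : ℝ => s ^ (1 - α) • ((R s).comp (R s))) (Ioi 0) := by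
      intro s hs
      simp only
      rw [aux_pow hs, smul_smul]
    refine ⟨(integrableOn_congr_fun he measurableSet_Ioi).1 hJ2, ?_⟩
    rw [← setIntegral_congr_fun measurableSet_Ioi he, hm, negPow, smul_comm]
  · have he : EqOn (fun s : ℝ => ((2 : ℝ) ^ (-α) * 2⁻¹) • ((2⁻¹ * s) ^ (-α) • R (2⁻¹ * s)))
        (fun s : ℝ => s ^ (-α) • R2 s) (Ioi 0) := by
      intro s hs
      have hs0 : (0 : ℝ) < s := hs
      simp only
      rw [aux_R2 hB hR2 hs0.le, smul_smul, smul_smul]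
      congr 1
      rw [mul_right_comm, ← Real.mul_rpow (by norm_num) (by positivity), mul_inv_cancel_left₀ two_ne_zero]
    have hi : IntegrableOn (fun s : ℝ => (2⁻¹ * s) ^ (-α) • R (2⁻¹ * s)) (Ioi 0) := by
      have := (integrableOn_Ioi_comp_mul_left_iff (fun s : ℝ => s ^ (-α) • R s) 0
        (a := (2⁻¹ : ℝ)) (by norm_num)).2 (by simpa using hJ1)
      exact this
    have hi2 := Integrable.smul ((2 : ℝ) ^ (-α) * 2⁻¹) hi
    refine ⟨(integrableOn_congr_fun he measurableSet_Ioi).1 hi2, ?_⟩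
    have hc := integral_comp_mul_left_Ioi (fun s : ℝ => s ^ (-α) • R s) 0
        (b := (2⁻¹ : ℝ)) (by norm_num)
    simp only [mul_zero, inv_inv] at hc
    rw [← setIntegral_congr_fun measurableSet_Ioi he, integral_smul, hc, negPow, smul_smul, smul_smul,
      smul_smul]
    congr 1
    ring
end
end
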